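/- Let (V, L, ∂) and (V', L', ∂') be crossed modules over Lie algebras with cokernel g and kernel M (both). Let V + V' be the pushout of i ⊕ i' : M ⊕ M → V ⊕ V' along the codiagonal ∇_M : M ⊕ M → M (as vector spaces), i.e., V + V' = (M ⊕ (V ⊕ V'))/{(m₁+m₂, -(i(m₁), i'(m₂)))}. Then (∂, ∂') : V ⊕ V' → L ×_g L' factors through a well-defined map θ̃ : V + V' → L ×_g L', and equipping V + V' with the (L ×_g L')-action [(x,x'), r(v,v')] = r([x,v],[x',v']) (r : V ⊕ V' → V + V' the quotient), (V + V', L ×_g L', θ̃) is a crossed module over a Lie algebra. -/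

import Mathlib

/-- The relation submodule defining the pushout `V + V'` of `i ⊕ i' : M ⊕ M → V ⊕ V'`
along the codiagonal `∇ : M ⊕ M → M`. -/
def pushoutRel (K M V V' : Type) [Field K] [AddCommGroup M] [Module K M]
    [AddCommGroup V] [Module K V] [AddCommGroup V'] [Module K V']
    (i : M →ₗ[K] V) (i' : M →ₗ[K] V') : Submodule K ((V × V') × M) :=
  LinearMap.range (LinearMap.prod
    (LinearMap.prod (i.comp (LinearMap.fst K M M)) (i'.comp (LinearMap.snd K M M)))
    (-(LinearMap.fst K M M + LinearMap.snd K M M)))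

theorem mem_pushoutRel {K M V V' : Type} [Field K] [AddCommGroup M] [Module K M]
    [AddCommGroup V] [Module K V] [AddCommGroup V'] [Module K V']
    {i : M →ₗ[K] V} {i' : M →ₗ[K] V'} {a : (V × V') × M} :
    a ∈ pushoutRel K M V V' i i' ↔ ∃ m n : M, ((i m, i' n), -(m + n)) = a := by
  simp [pushoutRel, LinearMap.mem_range, Prod.exists]

theorem exists_pushoutRel_mk_eq {K M V V' : Type} [Field K] [AddCommGroup M] [Module K M]
    [AddCommGroup V] [Module K V] [AddCommGroup V'] [Module K V']
    (i : M →ₗ[K] V) (i' : M →ₗ[K] V')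
    (a : ((V × V') × M) ⧸ pushoutRel K M V V' i i') :
    ∃ (v : V) (v' : V'), Submodule.Quotient.mk ((v, v'), (0 : M)) = a := by
  obtain ⟨⟨⟨v, v'⟩, m⟩, rfl⟩ := Submodule.Quotient.mk_surjective _ a
  refine ⟨v + i m, v', (Submodule.Quotient.eq _).2 (mem_pushoutRel.2 ⟨m, 0, ?_⟩)⟩
  simp

/-- The action of a compatible pair `(x, x')` on the pushout `V + V'`, where `p` is the action
on `M` that the actions of `x` and of `x'` both restrict to. -/
def pushoutMap {K M V V' : Type} [Field K] [AddCommGroup M] [Module K M]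
    [AddCommGroup V] [Module K V] [AddCommGroup V'] [Module K V']
    (i : M →ₗ[K] V) (i' : M →ₗ[K] V')
    (f : V →ₗ[K] V) (f' : V' →ₗ[K] V') (p : M →ₗ[K] M)
    (hf : ∀ m, i (p m) = f (i m)) (hf' : ∀ m, i' (p m) = f' (i' m)) :
    (((V × V') × M) ⧸ pushoutRel K M V V' i i') →ₗ[K]
      (((V × V') × M) ⧸ pushoutRel K M V V' i i') :=
  Submodule.mapQ _ _ ((f.prodMap f').prodMap p) (by
    intro a ha
    obtain ⟨m, n, rfl⟩ := mem_pushoutRel.1 ha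
    refine Submodule.mem_comap.2 (mem_pushoutRel.2 ⟨p m, p n, ?_⟩)
    simp [hf, hf'])

/-- for two crossed modules `(V, L, ∂)`, `(V', L', ∂')` with cokernel `g`
and kernel `M`, the map `(∂, ∂')` factors through a well-defined map
`θ̃ : V + V' → L ×_g L'` on the pushout `V + V' = ((V ⊕ V') ⊕ M)/{((i m₁, i' m₂), -(m₁+m₂))}`,
which together with the induced action of `L ×_g L'` makes `(V + V', L ×_g L', θ̃)` a crossed
module over a Lie algebra. -/
theorem crossed_ext_stmt14 {K L V L' V' g M : Type} [Field K]
    [LieRing L] [LieAlgebra K L]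
    [AddCommGroup V] [Module K V] [LieRingModule L V] [LieModule K L V]
    [LieRing L'] [LieAlgebra K L']
    [AddCommGroup V'] [Module K V'] [LieRingModule L' V'] [LieModule K L' V']
    [LieRing g] [LieAlgebra K g]
    [AddCommGroup M] [Module K M] [LieRingModule g M] [LieModule K g M]
    -- the two crossed modules with cokernel g
    (d : V →ₗ[K] L)
    (hmod : ∀ (x : L) (v : V), d ⁅x, v⁆ = ⁅x, d v⁆)
    (hcross : ∀ v w : V, ⁅d v, w⁆ = - ⁅d w, v⁆)
    (π : L →ₗ⁅K⁆ g) (hπ : Function.Surjective π)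
    (hker : ∀ z : L, π z = 0 ↔ z ∈ LinearMap.range d)
    (d' : V' →ₗ[K] L')
    (hmod' : ∀ (x : L') (v : V'), d' ⁅x, v⁆ = ⁅x, d' v⁆)
    (hcross' : ∀ v w : V', ⁅d' v, w⁆ = - ⁅d' w, v⁆)
    (π' : L' →ₗ⁅K⁆ g) (hπ' : Function.Surjective π')
    (hker' : ∀ z : L', π' z = 0 ↔ z ∈ LinearMap.range d')
    -- the common kernel M, included in V and in V'
    (i : M →ₗ[K] V) (hi : Function.Injective i)
    (hirange : LinearMap.range i = LinearMap.ker d)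
    (hiequiv : ∀ (x : L) (m : M), i ⁅π x, m⁆ = ⁅x, i m⁆)
    (i' : M →ₗ[K] V') (hi' : Function.Injective i')
    (hirange' : LinearMap.range i' = LinearMap.ker d')
    (hiequiv' : ∀ (x : L') (m : M), i' ⁅π' x, m⁆ = ⁅x, i' m⁆) :
    -- write Q for the pushout V + V' and mkQ for the quotient map
    let Q := ((V × V') × M) ⧸ pushoutRel K M V V' i i'
    let mkQ : ((V × V') × M) → Q := Submodule.Quotient.mk
    -- (∂, ∂') factors through a well-defined map θ̃ on Q, landing in the fibered product,
    ∃ θt : Q →ₗ[K] L × L',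
      (∀ (v : V) (v' : V') (m : M), θt (mkQ ((v, v'), m)) = (d v, d' v')) ∧
      (∀ a : Q, π (θt a).1 = π' (θt a).2) ∧
      -- and there is a well-defined action of the fibered product L ×_g L' on Q
      ∃ act : (L × L') → Q →ₗ[K] Q,
        -- induced by the componentwise action via the surjection r(v,v') = mkQ ((v,v'),0),
        (∀ (x : L) (x' : L'), π x = π' x' → ∀ (v : V) (v' : V'),
          act (x, x') (mkQ ((v, v'), 0)) = mkQ ((⁅x, v⁆, ⁅x', v'⁆), 0)) ∧
        -- which is a Lie module action,
        (∀ (x y : L) (x' y' : L'), π x = π' x' → π y = π' y' → ∀ a : Q,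
          act (⁅x, y⁆, ⁅x', y'⁆) a = act (x, x') (act (y, y') a) - act (y, y') (act (x, x') a)) ∧
        -- for which θ̃ is a map of modules,
        (∀ (x : L) (x' : L'), π x = π' x' → ∀ a : Q,
          θt (act (x, x') a) = (⁅x, (θt a).1⁆, ⁅x', (θt a).2⁆)) ∧
        -- and the crossed-module condition holds.
        (∀ a b : Q, act (θt a) b = - act (θt b) a) := by
  intro Q mkQ
  have hd : ∀ m, d (i m) = 0 := fun m => by
    rw [← LinearMap.mem_ker, ← hirange]; exact ⟨m, rfl⟩
  have hd' : ∀ m, d' (i' m) = 0 := fun m => by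
    rw [← LinearMap.mem_ker, ← hirange']; exact ⟨m, rfl⟩
  have hπd : ∀ v, π (d v) = 0 := fun v => (hker _).2 ⟨v, rfl⟩
  have hπd' : ∀ v, π' (d' v) = 0 := fun v => (hker' _).2 ⟨v, rfl⟩
  have hsurj : ∀ a : Q, ∃ (v : V) (v' : V'), mkQ ((v, v'), 0) = a :=
    exists_pushoutRel_mk_eq i i'
  let θt : Q →ₗ[K] L × L' :=
    Submodule.liftQ _ ((d.prodMap d').comp (LinearMap.fst K (V × V') M)) (by
      intro a ha
      obtain ⟨m, n, rfl⟩ := mem_pushoutRel.1 ha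
      simp [hd, hd'])
  have hθ : ∀ (v : V) (v' : V') (m : M), θt (mkQ ((v, v'), m)) = (d v, d' v') :=
    fun _ _ _ => rfl
  have hθπ : ∀ a : Q, π (θt a).1 = π' (θt a).2 := fun a => by
    obtain ⟨v, v', rfl⟩ := hsurj a
    rw [hθ, hπd, hπd']
  classical
  let act : (L × L') → Q →ₗ[K] Q := fun z =>
    if h : π z.1 = π' z.2 then
      pushoutMap i i' (LieModule.toEnd K L V z.1) (LieModule.toEnd K L' V' z.2)
        (LieModule.toEnd K g M (π z.1)) (fun m => hiequiv z.1 m)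
        (fun m => by simpa [h] using hiequiv' z.2 m)
    else 0
  have hact : ∀ (x : L) (x' : L'), π x = π' x' → ∀ (v : V) (v' : V'),
      act (x, x') (mkQ ((v, v'), 0)) = mkQ ((⁅x, v⁆, ⁅x', v'⁆), 0) := by
    intro x x' h v v'
    have hz : act (x, x') (mkQ ((v, v'), 0)) = mkQ ((⁅x, v⁆, ⁅x', v'⁆), ⁅π x, (0 : M)⁆) := by
      simp only [act, dif_pos h]
      rfl
    rw [hz, lie_zero]
  refine ⟨θt, hθ, hθπ, act, hact, ?_, ?_, ?_⟩
  · intro x y x' y' hx hy a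
    obtain ⟨v, v', rfl⟩ := hsurj a
    have hxy : π ⁅x, y⁆ = π' ⁅x', y'⁆ := by rw [LieHom.map_lie, LieHom.map_lie, hx, hy]
    rw [hact _ _ hxy, hact _ _ hy, hact _ _ hx, hact _ _ hx, hact _ _ hy,
      ← Submodule.Quotient.mk_sub]
    simp [mkQ, lie_lie]
  · intro x x' hx a
    obtain ⟨v, v', rfl⟩ := hsurj a
    rw [hact _ _ hx, hθ, hθ, hmod, hmod']
  · intro a b
    have ha := hθπ a
    have hb := hθπ b
    obtain ⟨v, v', rfl⟩ := hsurj a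
    obtain ⟨w, w', rfl⟩ := hsurj b
    rw [hθ] at ha hb ⊢
    rw [hθ, hact _ _ ha, hact _ _ hb, ← Submodule.Quotient.mk_neg, hcross, hcross']
    simp [mkQ]
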